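/- Let x : V → V → ℝ be any edge-weight function with x i j = 0 whenever (i,j) ∉ E, and let m' be the integer-valued function on strongly connected subsets of V defined by m'(V) = 1 and m'(W) = k(W) − ∑_{W' strongly connected, W ⊊ W' ⊆ V} m'(W') for strongly connected W ⊊ V. Then τ(Ḡ) · ∏_W Ψ_{V∖W}^{(−m'(W))₊} = τ(G) · ∏_W Ψ_{V∖W}^{(m'(W))₊}, where both products range over all strongly connected proper subsets W ⊊ V. (Equivalently, the ratio Φ_G = τ(Ḡ)/τ(G) equals ∏_W Ψ_{V∖W}^{m'(W)}.) -/

import Mathlib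

open Matrix Finset Classical

noncomputable section

/-- A directed rooted spanning tree of the graph with edge set `E`, rooted at `r`,
encoded as the "parent" function `t`. -/
def IsSpanningTree {V : Type*} (E : Set (V × V)) (r : V) (t : V → V) : Prop :=
  t r = r ∧ (∀ v, v ≠ r → (v, t v) ∈ E) ∧ ∀ v, ∃ n, t^[n] v = r

/-- The set `V̄` of all spanning trees of the graph, over all roots, as a type:
a pair of the parent function and the root. -/
abbrev STree {V : Type*} (E : Set (V × V)) : Type _ :=
  {p : (V → V) × V // IsSpanningTree E p.2 p.1}

def STree.tree {V : Type*} {E : Set (V × V)} (t : STree E) : V → V := t.1.1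

def STree.root {V : Type*} {E : Set (V × V)} (t : STree E) : V := t.1.2

noncomputable instance STree.instFintype {V : Type*} [Finite V] {E : Set (V × V)} :
    Fintype (STree E) := Fintype.ofFinite _

/-- The edge relation of the spanning tree graph `Ḡ`. -/
def STreeEdge {V : Type*} [DecidableEq V] (E : Set (V × V)) (t t' : STree E) : Prop :=
  t.root ≠ t'.root ∧ (t.root, t'.root) ∈ E ∧
    t'.tree = Function.update (Function.update t.tree t.root t'.root) t'.root t'.root

/-- The edge set of the spanning tree graph `Ḡ`. -/
def liftEdges {V : Type*} [DecidableEq V] (E : Set (V × V)) : Set (STree E × STree E) :=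
  {p | STreeEdge E p.1 p.2}

/-- The graph `(V, E)` is strongly connected. -/
def StronglyConnected {V : Type*} (E : Set (V × V)) : Prop :=
  ∀ u v : V, Relation.ReflTransGen (fun a b => (a, b) ∈ E) u v

/-- `W` is a (nonempty) strongly connected subset of the vertices: any two vertices of `W`
are joined by a directed path staying inside `W`. -/
def StronglyConnectedSub {V : Type*} (E : Set (V × V)) (W : Finset V) : Prop :=
  W.Nonempty ∧ ∀ u ∈ W, ∀ v ∈ W,
    Relation.ReflTransGen (fun a b => a ∈ W ∧ b ∈ W ∧ (a, b) ∈ E) u v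

/-- `P` is a transition matrix associated with the graph `(V, E)`. -/
def IsTransMatrix {V : Type*} [Fintype V] (E : Set (V × V)) (P : Matrix V V ℝ) : Prop :=
  (∀ i j, 0 ≤ P i j) ∧ (∀ i, ∑ j, P i j = 1) ∧ ∀ i j, i ≠ j → (0 < P i j ↔ (i, j) ∈ E)

/-- The lift `P̄` of the matrix `P` to the spanning tree graph. -/
def liftP {V : Type*} [DecidableEq V] (E : Set (V × V)) (P : Matrix V V ℝ) :
    Matrix (STree E) (STree E) ℝ :=
  fun t t' => if t = t' then P t.root t.root
    else if STreeEdge E t t' then P t.root t'.root else 0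

/-- A directed rooted spanning forest of the graph with edge set `E`, rooted in `W`. -/
def IsSpanningForest {V : Type*} (E : Set (V × V)) (W : Finset V) (f : V → V) : Prop :=
  (∀ w ∈ W, f w = w) ∧ (∀ v, v ∉ W → (v, f v) ∈ E) ∧ ∀ v, ∃ n, f^[n] v ∈ W

/-- `k(W)`: the number of spanning forests rooted in `W`. -/
def kForest {V : Type*} (E : Set (V × V)) (W : Finset V) : ℕ :=
  Nat.card {f : V → V // IsSpanningForest E W f}

/-- The `W × W` submatrix of `A` (rows and columns indexed by `W`). -/
def subm {V : Type*} {R : Type*} (A : Matrix V V R) (W : Finset V) : Matrix W W R :=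
  A.submatrix (fun i => (i : V)) (fun j => (j : V))

/-- `Ψ_W`: the sum of the weights of the spanning forests rooted in `W`,
for edge weights `x`. -/
def forestWeightSum {V : Type*} [Fintype V] [DecidableEq V] (E : Set (V × V))
    (x : V → V → ℝ) (W : Finset V) : ℝ :=
  ∑ f ∈ Finset.univ.filter (IsSpanningForest E W),
    ∏ v ∈ Finset.univ.filter (fun v => v ∉ W), x v (f v)

/-- The weight of a spanning tree: product of edge weights over non-root vertices. -/
def treeWeight {V : Type*} [Fintype V] [DecidableEq V] {E : Set (V × V)}
    (x : V → V → ℝ) (t : STree E) : ℝ :=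
  ∏ v ∈ Finset.univ.erase t.root, x v (t.tree v)

/-- `step(t, j)`: move the root of the (rooted function) `p` along the edge to `j`. -/
def stepF {V : Type*} [DecidableEq V] (E : Set (V × V)) (p : (V → V) × V) (j : V) :
    (V → V) × V :=
  if j = p.2 then p
  else if (p.2, j) ∈ E then (Function.update (Function.update p.1 p.2 j) j j, j)
  else p

/-- `traverse(c, p)`: successively apply `step` with the vertices `c 1, c 2, …, c (n-1), c 0`. -/
def traverse {V : Type*} [DecidableEq V] (E : Set (V × V)) (n : ℕ) (c : ZMod n → V)
    (p : (V → V) × V) : (V → V) × V :=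
  (List.range n).foldl (fun q i => stepF E q (c ((i : ZMod n) + 1))) p

section Alg

theorem trace_pow_nil {M : Type*} [AddCommGroup M] [Module ℂ M] [FiniteDimensional ℂ M]
    (f : Module.End ℂ M) (μ : ℂ) (h : IsNilpotent (f - algebraMap ℂ _ μ)) (n : ℕ) :
    LinearMap.trace ℂ M (f ^ n) = μ ^ n * Module.finrank ℂ M := by
  induction n with
  | zero => simp
  | succ n ih =>
    have hc : Commute (f ^ n) f := (Commute.refl f).pow_left n
    have := LinearMap.trace_comp_eq_mul_of_commute_of_isNilpotent μ hc h
    rw [pow_succ, Module.End.mul_eq_comp, this, ih]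
    ring

theorem trace_pow_end {M : Type*} [AddCommGroup M] [Module ℂ M] [FiniteDimensional ℂ M]
    (f : Module.End ℂ M) (S : Finset ℂ) (hS : ∀ μ, μ ∈ f.charpoly.roots → μ ∈ S) (n : ℕ) :
    LinearMap.trace ℂ M (f ^ n) = ∑ μ ∈ S, (f.charpoly.rootMultiplicity μ : ℂ) * μ ^ n := by
  have hds := DirectSum.isInternal_submodule_of_iSupIndep_of_iSup_eq_top
      f.independent_maxGenEigenspace (Module.End.iSup_maxGenEigenspace_eq_top f)
  have h_fin : {μ | f.maxGenEigenspace μ ≠ ⊥}.Finite :=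
      WellFoundedGT.finite_ne_bot_of_iSupIndep f.independent_maxGenEigenspace
  have hmt : ∀ μ, Set.MapsTo (f ^ n) (f.maxGenEigenspace μ) (f.maxGenEigenspace μ) := fun μ =>
    f.mapsTo_maxGenEigenspace_of_comm ((Commute.refl f).pow_right n) μ
  rw [LinearMap.trace_eq_sum_trace_restrict' hds h_fin hmt]
  have key : ∀ μ, LinearMap.trace ℂ _ ((f ^ n).restrict (hmt μ)) =
      (f.charpoly.rootMultiplicity μ : ℂ) * μ ^ n := by
    intro μ
    have hf' := f.mapsTo_maxGenEigenspace_of_comm (Commute.refl _) μ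
    have h1 := f.isNilpotent_restrict_maxGenEigenspace_sub_algebraMap μ
    have h2 := trace_pow_nil (f.restrict hf') μ (h1) n
    rw [← LinearMap.finrank_maxGenEigenspace_eq, mul_comm, ← h2]
    congr 1
    exact (Module.End.pow_restrict n hf').symm
  simp_rw [key]
  apply Finset.sum_subset_zero_on_sdiff
  · intro μ hμ
    apply hS
    simp only [Set.Finite.mem_toFinset, Set.mem_ofPred_eq] at hμ
    by_contra hcon
    have h0 : f.charpoly.rootMultiplicity μ = 0 := by
      rw [← Polynomial.count_roots]; exact Multiset.count_eq_zero.2 hcon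
    rw [← LinearMap.finrank_maxGenEigenspace_eq] at h0
    exact hμ (Submodule.finrank_eq_zero.1 h0)
  · intro μ hμ
    simp only [Finset.mem_sdiff, Set.Finite.mem_toFinset, Set.mem_ofPred_eq, not_not] at hμ
    rw [← LinearMap.finrank_maxGenEigenspace_eq, hμ.2]
    simp
  · intros; rfl

theorem trace_pow_mat {m : Type*} [Fintype m] [DecidableEq m] (A : Matrix m m ℂ)
    (S : Finset ℂ) (hS : ∀ μ, μ ∈ A.charpoly.roots → μ ∈ S) (n : ℕ) :
    (A ^ n).trace = ∑ μ ∈ S, (A.charpoly.rootMultiplicity μ : ℂ) * μ ^ n := by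
  have h := trace_pow_end (Matrix.toLin' A) S (by simpa using hS) n
  rw [← Matrix.toLin'_pow, Matrix.trace_toLin'_eq] at h
  simpa using h

theorem powers_indep (S : Finset ℂ) (c : ℂ → ℂ) (h : ∀ n : ℕ, ∑ μ ∈ S, c μ * μ ^ n = 0) :
    ∀ μ ∈ S, c μ = 0 := by
  have hli := linearIndependent_monoidHom (Multiplicative ℕ) ℂ
  have hinj : Function.Injective (powersHom ℂ) := (powersHom ℂ).injective
  have h2 := hli.comp _ hinj
  rw [linearIndependent_iff'] at h2
  refine h2 S c ?_
  funext n
  have := h n.toAdd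
  simpa [Finset.sum_apply, powersHom_apply] using this

/-- From traces to characteristic polynomials. -/
theorem charpoly_of_traces {ι m : Type*} [Fintype m] [DecidableEq m] (s : Finset ι)
    {k : ι → Type*} [∀ i, Fintype (k i)] [∀ i, DecidableEq (k i)]
    (A : Matrix m m ℝ) (B : ∀ i, Matrix (k i) (k i) ℝ) (c : ι → ℤ)
    (h : ∀ n : ℕ, (A ^ n).trace = ∑ i ∈ s, (c i : ℝ) * ((B i) ^ n).trace) :
    A.charpoly * ∏ i ∈ s, (B i).charpoly ^ (-(c i)).toNat
      = ∏ i ∈ s, (B i).charpoly ^ (c i).toNat := by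
  let φ : ℝ →+* ℂ := algebraMap ℝ ℂ
  have hφ : Function.Injective φ := (algebraMap ℝ ℂ).injective
  apply Polynomial.map_injective φ hφ
  simp only [Polynomial.map_mul, Polynomial.map_prod, Polynomial.map_pow, ← Matrix.charpoly_map]
  set A' := A.map φ with hA'
  set B' : ∀ i, Matrix (k i) (k i) ℂ := fun i => (B i).map φ with hB'
  have h' : ∀ n : ℕ, (A' ^ n).trace = ∑ i ∈ s, (c i : ℂ) * ((B' i) ^ n).trace := by
    intro n
    have e1 : ∀ {q : Type _} [Fintype q] [DecidableEq q] (M : Matrix q q ℝ),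
        ((M.map φ) ^ n).trace = φ ((M ^ n).trace) := by
      intro q _ _ M
      have : (M.map φ) ^ n = (M ^ n).map φ := by
        have := map_pow (φ.mapMatrix) M n
        simpa using this.symm
      rw [this]
      simp [Matrix.trace, map_sum]
    have e2 : ∀ i, ((B' i) ^ n).trace = φ (((B i) ^ n).trace) := fun i => by
      have : (B' i) ^ n = ((B i) ^ n).map φ := by
        have := map_pow (φ.mapMatrix) (B i) n
        simpa using this.symm
      rw [this]
      simp [Matrix.trace, map_sum]
    rw [e1, h n, map_sum]
    refine Finset.sum_congr rfl fun i _ => ?_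
    rw [e2]; simp
  let S : Finset ℂ := A'.charpoly.roots.toFinset ∪ s.biUnion fun i => (B' i).charpoly.roots.toFinset
  have hSA : ∀ μ, μ ∈ A'.charpoly.roots → μ ∈ S := fun μ hμ => by
    simp only [S, Finset.mem_union, Multiset.mem_toFinset]; exact Or.inl hμ
  have hSB : ∀ i ∈ s, ∀ μ, μ ∈ (B' i).charpoly.roots → μ ∈ S := fun i hi μ hμ => by
    simp only [S, Finset.mem_union, Multiset.mem_toFinset, Finset.mem_biUnion]
    exact Or.inr ⟨i, hi, hμ⟩
  have hz : ∀ μ ∈ S, (A'.charpoly.rootMultiplicity μ : ℂ) -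
      ∑ i ∈ s, (c i : ℂ) * ((B' i).charpoly.rootMultiplicity μ : ℂ) = 0 := by
    apply powers_indep S (fun μ => (A'.charpoly.rootMultiplicity μ : ℂ) -
      ∑ i ∈ s, (c i : ℂ) * ((B' i).charpoly.rootMultiplicity μ : ℂ))
    intro n
    simp only [sub_mul, Finset.sum_sub_distrib]
    rw [← trace_pow_mat A' S hSA n, h' n, sub_eq_zero]
    simp_rw [Finset.sum_mul]
    rw [Finset.sum_comm]
    refine Finset.sum_congr rfl fun i hi => ?_
    rw [trace_pow_mat (B' i) S (hSB i hi) n, Finset.mul_sum]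
    refine Finset.sum_congr rfl fun μ _ => by ring
  have hz' : ∀ μ, (A'.charpoly.rootMultiplicity μ : ℤ) =
      ∑ i ∈ s, (c i) * ((B' i).charpoly.rootMultiplicity μ : ℤ) := by
    intro μ
    by_cases hμ : μ ∈ S
    · have := sub_eq_zero.1 (hz μ hμ)
      exact_mod_cast this
    · have a1 : A'.charpoly.rootMultiplicity μ = 0 := by
        rw [← Polynomial.count_roots]; exact Multiset.count_eq_zero.2 fun h => hμ (hSA μ h)
      rw [a1]
      symm
      apply Finset.sum_eq_zero
      intro i hi
      have a2 : (B' i).charpoly.rootMultiplicity μ = 0 := by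
        rw [← Polynomial.count_roots]; exact Multiset.count_eq_zero.2 fun h => hμ (hSB i hi μ h)
      simp [a2]
  have mB : ∀ e : ι → ℕ, (∏ i ∈ s, (B' i).charpoly ^ e i).Monic := fun e =>
    Polynomial.monic_prod_of_monic _ _ fun i _ => (Matrix.charpoly_monic (B' i)).pow _
  have mA : A'.charpoly.Monic := Matrix.charpoly_monic A'
  have rB : ∀ e : ι → ℕ, (∏ i ∈ s, (B' i).charpoly ^ e i).roots =
      ∑ i ∈ s, e i • (B' i).charpoly.roots := by
    intro e
    rw [Polynomial.roots_prod _ _ (mB e).ne_zero]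
    simp only [Polynomial.roots_pow]
    rfl
  have hr : (A'.charpoly * ∏ i ∈ s, (B' i).charpoly ^ (-(c i)).toNat).roots =
      (∏ i ∈ s, (B' i).charpoly ^ (c i).toNat).roots := by
    rw [Polynomial.roots_mul (mA.mul (mB _)).ne_zero, rB, rB]
    ext μ
    simp only [Multiset.count_add, Multiset.count_sum', Multiset.count_nsmul, Polynomial.count_roots]
    zify
    rw [hz' μ, ← Finset.sum_add_distrib]
    refine Finset.sum_congr rfl fun i _ => ?_
    rw [← add_mul]
    congr 1
    have := Int.toNat_sub_toNat_neg (c i)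
    linarith
  have s1 := (IsAlgClosed.splits
    (A'.charpoly * ∏ i ∈ s, (B' i).charpoly ^ (-(c i)).toNat)).eq_prod_roots_of_monic (mA.mul (mB _))
  have s2 := (IsAlgClosed.splits
    (∏ i ∈ s, (B' i).charpoly ^ (c i).toNat)).eq_prod_roots_of_monic (mB _)
  rw [s1, s2, hr]

end Alg
section Forest

def lapl {V : Type*} [Fintype V] [DecidableEq V] (y : V → V → ℝ) : Matrix V V ℝ :=
  fun i j => (if i = j then ∑ k, y i k else 0) - y i j

def extF {V : Type*} (W : Finset V) (r : W → V) : V → V :=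
  fun v => if h : v ∈ W then r ⟨v, h⟩ else v

theorem extF_out {V : Type*} (W : Finset V) (r : W → V) (v : V) (hv : v ∉ W) (n : ℕ) :
    (extF W r)^[n] v = v := by
  apply Function.iterate_fixed
  simp [extF, hv]

theorem extF_mono {V : Type*} (W : Finset V) (r : W → V) (v : V) (n m : ℕ) (h : n ≤ m)
    (hv : (extF W r)^[n] v ∉ W) : (extF W r)^[m] v ∉ W := by
  obtain ⟨k, rfl⟩ := Nat.exists_eq_add_of_le h
  rw [add_comm, Function.iterate_add_apply, extF_out _ _ _ hv]
  exact hv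

theorem det_one_sub_nil {m : Type*} [Fintype m] [DecidableEq m] (N : Matrix m m ℝ)
    (h : IsNilpotent N) : (1 - N).det = 1 := by
  have h1 := (Matrix.isNilpotent_charpoly_sub_pow_of_isNilpotent h).eq_zero
  have h2 : N.charpoly.eval 1 = 1 := by
    rw [sub_eq_zero.1 h1]; simp
  rw [Matrix.eval_charpoly] at h2
  simpa using h2

theorem det_fun {V : Type*} [Fintype V] [DecidableEq V] (W : Finset V) (r : W → V) :
    Matrix.det (Matrix.of fun i j : W =>
      (if i = j then (1:ℝ) else 0) - (if r i = (j : V) then 1 else 0)) =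
      if ∀ v, ∃ n, (extF W r)^[n] v ∉ W then 1 else 0 := by
  set F := extF W r with hF
  have hFr : ∀ i : W, F i = r i := fun i => by simp [hF, extF]
  split_ifs with h
  · let N : Matrix W W ℝ := fun i j => if r i = (j : V) then 1 else 0
    have hN : ∀ n, ∀ i j : W, (N ^ n) i j = if F^[n] (i : V) = j then 1 else 0 := by
      intro n
      induction n with
      | zero =>
        intro i j
        by_cases hij : i = j
        · subst hij; simp
        · have hne : (i : V) ≠ j := fun e => hij (Subtype.ext e)
          simp [hne, hij]
      | succ n ih =>
        intro i j
        rw [pow_succ', Matrix.mul_apply]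
        simp_rw [ih]
        rw [Function.iterate_succ_apply, hFr]
        by_cases hr : r i ∈ W
        · rw [Finset.sum_eq_single ⟨r i, hr⟩]
          · simp [N]
          · intro b _ hb
            have : r i ≠ b := fun e => hb (Subtype.ext e.symm)
            simp [N, this]
          · simp
        · rw [extF_out _ _ _ hr]
          have e1 : r i ≠ j := fun e => hr (e ▸ j.2)
          rw [if_neg e1]
          apply Finset.sum_eq_zero
          intro b _
          have : r i ≠ b := fun e => hr (e ▸ b.2)
          simp [N, this]
    have hnil : IsNilpotent N := by
      choose d hd using h
      refine ⟨Finset.univ.sup d, ?_⟩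
      ext i j
      rw [hN]
      have := extF_mono W r i (d i) _ (Finset.le_sup (Finset.mem_univ (i : V))) (hd i)
      have e1 : F^[Finset.univ.sup d] (i : V) ≠ j := fun e => this (e ▸ j.2)
      simp [e1]
    have := det_one_sub_nil N hnil
    refine Eq.trans ?_ this
    congr 1
  · push Not at h
    obtain ⟨v, hv⟩ := h
    rw [← Matrix.exists_mulVec_eq_zero_iff]
    have hvW : v ∈ W := hv 0
    refine ⟨fun i : W => if ∀ n, F^[n] (i : V) ∈ W then 1 else 0, ?_, ?_⟩
    · intro e
      have := congrFun e ⟨v, hvW⟩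
      simp [hv] at this
    · funext i
      simp only [Matrix.mulVec, dotProduct, Matrix.of_apply, sub_mul, Finset.sum_sub_distrib, ite_mul, one_mul, zero_mul,
        Finset.sum_ite_eq, Finset.mem_univ, if_true, Pi.zero_apply]
      have key : (∀ n, F^[n] (i : V) ∈ W) ↔ ∀ n, F^[n] (r i) ∈ W := by
        constructor
        · intro h n
          have := h (n+1)
          rwa [Function.iterate_succ_apply, hFr] at this
        · intro h n
          cases n with
          | zero => exact i.2
          | succ n => rw [Function.iterate_succ_apply, hFr]; exact h n
      by_cases hr : r i ∈ W
      · rw [Finset.sum_eq_single ⟨r i, hr⟩]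
        · simp [key]
        · intro b _ hb
          have : r i ≠ b := fun e => hb (Subtype.ext e.symm)
          simp [this]
        · simp
      · have h1 : ¬ ∀ n, F^[n] (i : V) ∈ W := fun h => hr (key.1 h 0)
        rw [if_neg h1, Finset.sum_eq_zero, sub_zero]
        intro b _
        have : r i ≠ b := fun e => hr (e ▸ b.2)
        simp [this]

theorem forest_det {V : Type*} [Fintype V] [DecidableEq V] (E : Set (V × V))
    (y : V → V → ℝ) (hy : ∀ i j, (i, j) ∉ E → y i j = 0) (W : Finset V) :
    (subm (lapl y) W).det = forestWeightSum E y Wᶜ := by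
  have h1 : subm (lapl y) W = fun i : W => ∑ k : V, y i k •
      (fun j : W => (if i = j then (1:ℝ) else 0) - (if k = (j : V) then 1 else 0)) := by
    ext i j
    simp only [subm, lapl, Matrix.submatrix_apply, Finset.sum_apply, Pi.smul_apply, smul_eq_mul,
      mul_sub, Finset.sum_sub_distrib]
    congr 1
    · by_cases h : i = j
      · simp [h]
      · have : (i : V) ≠ j := fun e => h (Subtype.ext e)
        simp [h, this]
    · simp
  have h2 : (subm (lapl y) W).det = ∑ r : W → V, (∏ i : W, y i (r i)) *
      (if ∀ v, ∃ n, (extF W r)^[n] v ∉ W then 1 else 0) := by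
    rw [h1]
    change Matrix.detRowAlternating.toMultilinearMap _ = _
    rw [MultilinearMap.map_sum]
    refine Finset.sum_congr rfl fun r _ => ?_
    rw [MultilinearMap.map_smul_univ, ← det_fun]
    rfl
  have h3 : ∀ r : W → V, (∏ i : W, y i (r i)) *
      (if ∀ v, ∃ n, (extF W r)^[n] v ∉ W then 1 else 0) =
      if IsSpanningForest E Wᶜ (extF W r) then (∏ i : W, y i (r i)) else 0 := by
    intro r
    by_cases hv : ∀ i : W, ((i : V), r i) ∈ E
    · have : IsSpanningForest E Wᶜ (extF W r) ↔ ∀ v, ∃ n, (extF W r)^[n] v ∉ W := by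
        constructor
        · intro h v
          simpa using h.2.2 v
        · intro h
          refine ⟨?_, ?_, ?_⟩
          · intro w hw
            exact extF_out W r w (by simpa using hw) 1
          · intro v hv'
            have hvW : v ∈ W := by simpa using hv'
            simpa [extF, hvW] using hv ⟨v, hvW⟩
          · simpa using h
      simp [this]
    · push Not at hv
      obtain ⟨i, hi⟩ := hv
      have : (∏ i : W, y i (r i)) = 0 := Finset.prod_eq_zero (Finset.mem_univ i) (hy _ _ hi)
      rw [this]; simp
  rw [h2, Finset.sum_congr rfl fun r _ => h3 r, ← Finset.sum_filter, forestWeightSum]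
  refine Finset.sum_nbij' (fun r => extF W r) (fun f i => f i) ?_ ?_ ?_ ?_ ?_
  · intro r hr
    simpa using hr
  · intro f hf
    simp only [Finset.mem_filter, Finset.mem_univ, true_and] at hf ⊢
    have : extF W (fun i : W => f i) = f := by
      funext v
      by_cases h : v ∈ W
      · simp [extF, h]
      · simp [extF, h, hf.1 v (by simpa using h)]
    rwa [this]
  · intro r _
    funext i
    simp [extF]
  · intro f hf
    simp only [Finset.mem_filter, Finset.mem_univ, true_and] at hf
    funext v
    by_cases h : v ∈ W
    · simp [extF, h]
    · simp [extF, h, hf.1 v (by simpa using h)]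
  · intro r _
    have : (Finset.univ.filter fun v => v ∉ Wᶜ) = W := by ext; simp
    rw [this, ← Finset.prod_coe_sort W]
    refine Finset.prod_congr rfl fun i _ => ?_
    simp [extF]

end Forest
section Coeff

theorem lapl_det {V : Type*} [Fintype V] [DecidableEq V] [Nonempty V] (y : V → V → ℝ) :
    (lapl y).det = 0 := by
  rw [← Matrix.exists_mulVec_eq_zero_iff]
  refine ⟨fun _ => 1, ?_, ?_⟩
  · intro e
    have := congrFun e (Classical.arbitrary V)
    simp at this
  · funext i
    simp [Matrix.mulVec, dotProduct, lapl]

theorem charpoly_neg_coeff_zero {m : Type*} [Fintype m] [DecidableEq m] (M : Matrix m m ℝ) :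
    (-M).charpoly.coeff 0 = M.det := by
  rw [Polynomial.coeff_zero_eq_eval_zero, Matrix.eval_charpoly]
  simp

theorem sum_stree {V : Type*} [Fintype V] [DecidableEq V] (E : Set (V × V))
    (y : V → V → ℝ) :
    ∑ r : V, forestWeightSum E y {r} = ∑ t : STree E, treeWeight y t := by
  have h1 : ∑ t : STree E, treeWeight y t =
      ∑ p ∈ Finset.univ.filter (fun p : (V → V) × V => IsSpanningTree E p.2 p.1),
        ∏ v ∈ Finset.univ.erase p.2, y v (p.1 v) := by
    symm
    exact Finset.sum_subtype (p := fun p : (V → V) × V => IsSpanningTree E p.2 p.1)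
      (F := STree.instFintype) _ (fun p => by simp) _
  rw [h1, Finset.sum_filter, Fintype.sum_prod_type, Finset.sum_comm]
  refine Finset.sum_congr rfl fun r _ => ?_
  rw [forestWeightSum, ← Finset.sum_filter]
  apply Finset.sum_congr
  · ext f
    rw [Finset.mem_filter, Finset.mem_filter]
    simp [IsSpanningForest, IsSpanningTree]
  · intro f _
    apply Finset.prod_congr
    · ext v; simp
    · intros; rfl

theorem coeff_one_lapl {V : Type*} [Fintype V] [DecidableEq V] [Nonempty V] (E : Set (V × V))
    (y : V → V → ℝ) (hy : ∀ i j, (i, j) ∉ E → y i j = 0) :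
    (-(lapl y)).charpoly.coeff 1 = ∑ t : STree E, treeWeight y t := by
  have hc : 0 < Fintype.card V := Fintype.card_pos
  have h := Matrix.charpoly_coeff_eq_sum_minors (-(lapl y)) (Fintype.card V - 1) (by omega)
  have e : Fintype.card V - (Fintype.card V - 1) = 1 := by omega
  rw [e] at h
  rw [h, ← sum_stree E y, Finset.mul_sum]
  symm
  refine Finset.sum_bij (fun r _ => ({r} : Finset V)ᶜ) ?_ ?_ ?_ ?_
  · intro r _
    simp [Finset.mem_powersetCard, Finset.card_compl]
  · intro a _ b _ hab
    simpa using hab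
  · intro s hs
    rw [Finset.mem_powersetCard] at hs
    have : sᶜ.card = 1 := by rw [Finset.card_compl, hs.2]; omega
    obtain ⟨r, hr⟩ := Finset.card_eq_one.1 this
    exact ⟨r, Finset.mem_univ _, by rw [← hr, compl_compl]⟩
  · intro r _
    have h2 := forest_det E y hy ({r} : Finset V)ᶜ
    rw [compl_compl] at h2
    rw [← h2, Matrix.submatrix_neg, Pi.neg_apply, Pi.neg_apply, Matrix.det_neg]
    rw [← mul_assoc, Fintype.card_coe, Finset.card_compl, Finset.card_singleton, ← pow_add,
      Even.neg_one_pow ⟨_, rfl⟩, one_mul]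
    rfl

end Coeff
section Comb

set_option linter.unusedSectionVars false

variable {V : Type*} [Fintype V] [DecidableEq V]

theorem stepF_tree (E : Set (V × V)) (p : (V → V) × V) (j : V) (hp : IsSpanningTree E p.2 p.1) :
    IsSpanningTree E (stepF E p j).2 (stepF E p j).1 := by
  unfold stepF
  split_ifs with h1 h2
  · exact hp
  · obtain ⟨t, r⟩ := p
    obtain ⟨h3, h4, h5⟩ := hp
    simp only at h1 h2 h3 h4 h5 ⊢
    set t' := Function.update (Function.update t r j) j j with ht'
    have tj : t' j = j := by simp [ht']
    have tr : t' r = j := by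
      rw [ht', Function.update_of_ne (Ne.symm h1), Function.update_self]
    have tv : ∀ v, v ≠ j → v ≠ r → t' v = t v := fun v a b => by
      rw [ht', Function.update_of_ne a, Function.update_of_ne b]
    refine ⟨tj, ?_, ?_⟩
    · intro v hv
      by_cases hr : v = r
      · subst hr; rw [tr]; exact h2
      · rw [tv v hv hr]; exact h4 v hr
    · intro v
      obtain ⟨n, hn⟩ := h5 v
      induction n generalizing v with
      | zero => exact ⟨1, by simp only [Function.iterate_zero, id] at hn; subst hn; exact tr⟩
      | succ n ih =>
        by_cases hj : v = j
        · exact ⟨0, hj⟩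
        · by_cases hr : v = r
          · exact ⟨1, by subst hr; exact tr⟩
          · obtain ⟨m, hm⟩ := ih (t v) hn
            exact ⟨m + 1, by rw [Function.iterate_succ_apply, tv v hj hr]; exact hm⟩
  · exact hp

def sstep {E : Set (V × V)} (t : STree E) (j : V) : STree E :=
  ⟨stepF E t.1 j, stepF_tree E t.1 j t.2⟩

def steps {E : Set (V × V)} (t : STree E) (l : List V) : STree E := l.foldl sstep t

def okw (E : Set (V × V)) : V → List V → Prop
  | _, [] => True
  | a, j :: l => (a = j ∨ (a, j) ∈ E) ∧ okw E j l

def lst : V → List V → V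
  | a, [] => a
  | _, j :: l => lst j l

def wt (Q : V → V → ℝ) : V → List V → ℝ
  | _, [] => 1
  | a, j :: l => Q a j * wt Q j l

theorem lst_mem (l : List V) (hl : l ≠ []) (a : V) : lst a l ∈ l := by
  induction l generalizing a with
  | nil => exact absurd rfl hl
  | cons j l ih =>
    by_cases h : l = []
    · subst h; simp [lst]
    · exact List.mem_cons_of_mem _ (ih h j)

theorem lst_eq (l : List V) (hl : l ≠ []) (a b : V) : lst a l = lst b l := by
  cases l with
  | nil => exact absurd rfl hl
  | cons j l => rfl

theorem wt_ok {E : Set (V × V)} {Q : V → V → ℝ} (hQ : ∀ i j, i ≠ j → (i, j) ∉ E → Q i j = 0)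
    (l : List V) (a : V) (h : wt Q a l ≠ 0) : okw E a l := by
  induction l generalizing a with
  | nil => trivial
  | cons j l ih =>
    have h1 := left_ne_zero_of_mul h
    have h2 := right_ne_zero_of_mul h
    refine ⟨?_, ih j h2⟩
    by_contra hc
    push Not at hc
    exact h1 (hQ _ _ hc.1 hc.2)

theorem sstep_root {E : Set (V × V)} (t : STree E) (j : V) (h : t.root = j ∨ (t.root, j) ∈ E) :
    (sstep t j).root = j := by
  simp only [sstep, STree.root, stepF] at h ⊢
  split_ifs with h1 h2
  · exact h1.symm
  · rfl
  · rcases h with h | h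
    · exact h
    · exact absurd h h2

theorem sstep_tree {E : Set (V × V)} (t : STree E) (j : V) (h : t.root = j ∨ (t.root, j) ∈ E) :
    (sstep t j).tree = Function.update (Function.update t.tree t.root j) j j := by
  have htr : t.tree t.root = t.root := t.2.1
  simp only [sstep, STree.root, STree.tree, stepF] at h htr ⊢
  split_ifs with h1 h2
  · subst h1
    rw [Function.update_idem]
    exact (Function.update_eq_self_iff.2 htr.symm).symm
  · rfl
  · rcases h with h | h
    · exact absurd h.symm h1
    · exact absurd h h2

theorem steps_root {E : Set (V × V)} (l : List V) (t : STree E) (h : okw E t.root l) :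
    (steps t l).root = lst t.root l := by
  induction l generalizing t with
  | nil => rfl
  | cons j l ih =>
    have hr := sstep_root t j h.1
    have := ih (sstep t j) (by rw [hr]; exact h.2)
    rw [hr] at this
    exact this

theorem steps_agree {E : Set (V × V)} (l : List V) (t1 t2 : STree E) (S : Set V)
    (hr : t1.root = t2.root) (hS : t1.root ∈ S) (h : ∀ v ∈ S, t1.tree v = t2.tree v)
    (ho : okw E t1.root l) :
    ∀ v, v ∈ S ∨ v ∈ l → (steps t1 l).tree v = (steps t2 l).tree v := by
  induction l generalizing t1 t2 S with
  | nil => intro v hv; exact h v (by simpa using hv)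
  | cons j l ih =>
    intro v hv
    have r1 := sstep_root t1 j ho.1
    have r2 := sstep_root t2 j (hr ▸ ho.1)
    refine ih (sstep t1 j) (sstep t2 j) (insert j S) (r1.trans r2.symm) ?_ ?_ ?_ v ?_
    · rw [r1]; exact Set.mem_insert _ _
    · intro u hu
      rw [sstep_tree t1 j ho.1, sstep_tree t2 j (hr ▸ ho.1), ← hr]
      by_cases huj : u = j
      · subst huj; simp
      · rw [Function.update_of_ne huj, Function.update_of_ne huj]
        by_cases hur : u = t1.root
        · subst hur; simp
        · rw [Function.update_of_ne hur, Function.update_of_ne hur]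
          exact h u (hu.resolve_left huj)
    · rw [r1]; exact ho.2
    · rcases hv with hv | hv
      · exact Or.inl (Or.inr hv)
      · rcases List.mem_cons.1 hv with hv | hv
        · exact Or.inl (Or.inl hv)
        · exact Or.inr hv

theorem steps_maps {E : Set (V × V)} (W : Set V) (l : List V) (t1 : STree E) (S : Set V)
    (h : ∀ v ∈ S, t1.tree v ∈ W) (hl : ∀ v ∈ l, v ∈ W)
    (ho : okw E t1.root l) :
    ∀ v, v ∈ S ∨ v ∈ l → (steps t1 l).tree v ∈ W := by
  induction l generalizing t1 S with
  | nil => intro v hv; exact h v (by simpa using hv)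
  | cons j l ih =>
    intro v hv
    have r1 := sstep_root t1 j ho.1
    have hj : j ∈ W := hl j (by simp)
    refine ih (sstep t1 j) (insert j S) ?_ (fun v hv => hl v (by simp [hv])) ?_ v ?_
    · intro u hu
      rw [sstep_tree t1 j ho.1]
      by_cases huj : u = j
      · subst huj; simpa using hj
      · rw [Function.update_of_ne huj]
        by_cases hur : u = t1.root
        · subst hur; simpa using hj
        · rw [Function.update_of_ne hur]
          exact h u (hu.resolve_left huj)
    · rw [r1]; exact ho.2
    · rcases hv with hv | hv
      · exact Or.inl (Or.inr hv)
      · rcases List.mem_cons.1 hv with hv | hv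
        · exact Or.inl (Or.inl hv)
        · exact Or.inr hv

theorem steps_out {E : Set (V × V)} (l : List V) (t1 : STree E) (v : V) (hv : v ≠ t1.root)
    (hl : v ∉ l) (ho : okw E t1.root l) :
    (steps t1 l).tree v = t1.tree v := by
  induction l generalizing t1 with
  | nil => rfl
  | cons j l ih =>
    have r1 := sstep_root t1 j ho.1
    simp only [List.mem_cons, not_or] at hl
    refine (ih (sstep t1 j) ?_ hl.2 ?_).trans ?_
    · rw [r1]; exact hl.1
    · rw [r1]; exact ho.2
    · rw [sstep_tree t1 j ho.1, Function.update_of_ne hl.1, Function.update_of_ne hv]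

theorem exists_tree (E : Set (V × V)) (hconn : StronglyConnected E) (r : V) :
    ∃ t : STree E, t.root = r := by
  have h : ∀ v, ∃ (n : ℕ) (p : ℕ → V), p 0 = v ∧ p n = r ∧ ∀ i < n, (p i, p (i+1)) ∈ E := by
    intro v
    induction hconn v r using Relation.ReflTransGen.head_induction_on with
    | refl => exact ⟨0, fun _ => r, rfl, rfl, by simp⟩
    | @head a b hab _ ih =>
      obtain ⟨n, p, h0, hn, hp⟩ := ih
      refine ⟨n+1, fun i => Nat.casesOn i a p, rfl, hn, ?_⟩
      intro i hi
      cases i with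
      | zero => simpa [h0] using hab
      | succ i => exact hp i (by omega)
  let d : V → ℕ := fun v => Nat.find (h v)
  have hd : ∀ v, v ≠ r → ∃ u, (v, u) ∈ E ∧ d u < d v := by
    intro v hv
    obtain ⟨p, h0, hn, hp⟩ := Nat.find_spec (h v)
    have hpos : 0 < d v := by
      rcases Nat.eq_zero_or_pos (d v) with e | e
      · exfalso
        have e' : Nat.find (h v) = 0 := e
        rw [e'] at hn
        exact hv (h0.symm.trans hn)
      · exact e
    refine ⟨p 1, ?_, ?_⟩
    · have := hp 0 hpos
      rwa [h0] at this
    · have : d (p 1) ≤ d v - 1 := by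
        apply Nat.find_min'
        refine ⟨fun i => p (i+1), rfl, ?_, ?_⟩
        · show p (d v - 1 + 1) = r
          rw [Nat.sub_add_cancel hpos]; exact hn
        · intro i hi
          exact hp (i+1) (by have : i < d v - 1 := hi; change i + 1 < d v; omega)
      omega
  choose! g hg using hd
  let t : V → V := fun v => if v = r then r else g v
  refine ⟨⟨(t, r), by simp [t], ?_, ?_⟩, rfl⟩
  · intro v hv
    simp only at hv
    simpa [t, hv] using (hg v hv).1
  · intro v
    show ∃ n, t^[n] v = r
    have : ∀ k v, d v ≤ k → ∃ n, t^[n] v = r := by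
      intro k
      induction k with
      | zero =>
        intro v hk
        by_cases hv : v = r
        · exact ⟨0, hv⟩
        · have := (hg v hv).2; omega
      | succ k ih =>
        intro v hk
        by_cases hv : v = r
        · exact ⟨0, hv⟩
        · have h2 := (hg v hv).2
          obtain ⟨n, hn⟩ := ih (g v) (by omega)
          exact ⟨n+1, by rw [Function.iterate_succ_apply]; simpa [t, hv] using hn⟩
    exact this _ v le_rfl

theorem stree_ext {E : Set (V × V)} {t1 t2 : STree E} (h : t1.root = t2.root)
    (h2 : ∀ v, t1.tree v = t2.tree v) : t1 = t2 := by
  apply Subtype.ext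
  exact Prod.ext (funext h2) h

theorem count_fixed (E : Set (V × V)) (hconn : StronglyConnected E) (r : V) (l : List V)
    (hl : l ≠ []) (hr : lst r l = r) (ho : okw E r l) :
    Nat.card {t : STree E // t.root = r ∧ steps t l = t} = kForest E l.toFinset := by
  set W := l.toFinset with hW
  have hmW : ∀ v, v ∈ W ↔ v ∈ l := by simp [hW]
  have hrl : r ∈ l := by
    have := lst_mem l hl r
    rwa [hr] at this
  have hrW : r ∈ W := (hmW r).2 hrl
  unfold kForest
  have hfor : ∀ t : {t : STree E // t.root = r ∧ steps t l = t},
      IsSpanningForest E W (fun v => if v ∈ W then v else t.1.tree v) := by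
    intro ⟨t, htr, hts⟩
    refine ⟨fun w hw => by simp [hw], ?_, ?_⟩
    · intro v hv
      simp only [hv, if_false]
      refine t.2.2.1 v ?_
      intro e
      exact hv (by rw [e]; change t.root ∈ W; rw [htr]; exact hrW)
    · intro v
      obtain ⟨n, hn⟩ := t.2.2.2 v
      change t.tree^[n] v = t.root at hn
      rw [htr] at hn
      induction n generalizing v with
      | zero => exact ⟨0, by simp only [Function.iterate_zero, id] at hn ⊢; rw [hn]; exact hrW⟩
      | succ n ih =>
        by_cases hv : v ∈ W
        · exact ⟨0, hv⟩
        · obtain ⟨m, hm⟩ := ih (t.tree v) hn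
          refine ⟨m+1, ?_⟩
          rw [Function.iterate_succ_apply]
          simpa only [hv, if_false] using hm
  refine Nat.card_eq_of_bijective (fun t => ⟨_, hfor t⟩) ⟨?_, ?_⟩
  · intro t1 t2 h12
    have h12' := congrFun (Subtype.ext_iff.1 h12)
    simp only at h12'
    obtain ⟨t1, h1r, h1s⟩ := t1
    obtain ⟨t2, h2r, h2s⟩ := t2
    apply Subtype.ext
    apply stree_ext (h1r.trans h2r.symm)
    intro v
    by_cases hv : v ∈ W
    · have := steps_agree l t1 t2 {r} (h1r.trans h2r.symm) (by simp [h1r]) (by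
        intro v hv
        rw [Set.mem_singleton_iff] at hv
        subst hv
        have e1 : t1.tree t1.root = t1.root := t1.2.1
        have e2 : t2.tree t2.root = t2.root := t2.2.1
        rw [h1r] at e1
        rw [h2r] at e2
        rw [e1, e2]) (by rw [h1r]; exact ho) v (Or.inr ((hmW v).1 hv))
      rwa [h1s, h2s] at this
    · simpa [hv] using h12' v
  · intro ⟨f, hf⟩
    obtain ⟨t0, h0r⟩ := exists_tree E hconn r
    set t1 := steps t0 l with ht1
    have h1r : t1.root = r := by
      rw [ht1, steps_root l t0 (by rw [h0r]; exact ho), h0r, hr]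
    have h0t : t0.tree r = r := by
      have e1 : t0.tree t0.root = t0.root := t0.2.1
      rwa [h0r] at e1
    have h1t : t1.tree r = r := by
      have e1 : t1.tree t1.root = t1.root := t1.2.1
      rwa [h1r] at e1
    have h1m : ∀ v ∈ W, t1.tree v ∈ W := by
      intro v hv
      exact steps_maps (W : Set V) l t0 {r} (by simp [h0t, hrW]) (fun v hv => by simpa [hW] using hv)
        (by rw [h0r]; exact ho) v (Or.inr ((hmW v).1 hv))
    let g : V → V := fun v => if v ∈ W then t1.tree v else f v
    have gW : ∀ v ∈ W, g v = t1.tree v := fun v hv => by simp [g, hv]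
    have gO : ∀ v, v ∉ W → g v = f v := fun v hv => by simp [g, hv]
    have reachW : ∀ n, ∀ v ∈ W, g^[n] v = t1.tree^[n] v := by
      intro n
      induction n with
      | zero => intro v _; rfl
      | succ n ih =>
        intro v hv
        rw [Function.iterate_succ_apply, Function.iterate_succ_apply, gW v hv, ih _ (h1m v hv)]
    have hg : IsSpanningTree E r g := by
      refine ⟨by rw [gW r hrW, h1t], ?_, ?_⟩
      · intro v hv
        by_cases hvW : v ∈ W
        · rw [gW v hvW]
          exact t1.2.2.1 v (by change v ≠ t1.root; rw [h1r]; exact hv)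
        · rw [gO v hvW]
          exact hf.2.1 v hvW
      · intro v
        obtain ⟨n, hn⟩ := hf.2.2 v
        induction n generalizing v with
        | zero =>
          obtain ⟨m, hm⟩ := t1.2.2.2 v
          change t1.tree^[m] v = t1.root at hm
          exact ⟨m, by rw [reachW m v hn, hm, h1r]⟩
        | succ n ih =>
          by_cases hvW : v ∈ W
          · obtain ⟨m, hm⟩ := t1.2.2.2 v
            change t1.tree^[m] v = t1.root at hm
            exact ⟨m, by rw [reachW m v hvW, hm, h1r]⟩
          · obtain ⟨m, hm⟩ := ih (f v) hn
            exact ⟨m+1, by rw [Function.iterate_succ_apply, gO v hvW]; exact hm⟩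
    let t2 : STree E := ⟨(g, r), hg⟩
    have h2r : t2.root = r := rfl
    have h2t : ∀ v, t2.tree v = g v := fun v => rfl
    refine ⟨⟨t2, h2r, ?_⟩, ?_⟩
    · apply stree_ext
      · rw [steps_root l t2 (by rw [h2r]; exact ho), h2r, hr]
      · intro v
        by_cases hv : v ∈ W
        · rw [steps_agree l t2 t0 {r} (h2r.trans h0r.symm) (by simp [h2r]) (by
            intro v hv
            rw [Set.mem_singleton_iff] at hv
            subst hv
            rw [h0t, h2t, gW _ hrW, h1t]) (by rw [h2r]; exact ho) v (Or.inr ((hmW v).1 hv)),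
            h2t, gW v hv]
        · exact steps_out l t2 v (by rw [h2r]; rintro rfl; exact hv hrW)
            (fun h => hv ((hmW v).2 h)) (by rw [h2r]; exact ho)
    · apply Subtype.ext
      funext v
      by_cases hv : v ∈ W
      · simp [hv, hf.1 v hv]
      · simp only [hv, if_false]
        rw [h2t, gO v hv]

theorem walk_reach {E : Set (V × V)} (W : Finset V) (l : List V) (a : V) (ha : a ∈ W)
    (hl : ∀ v ∈ l, v ∈ W) (ho : okw E a l) :
    ∀ v, v = a ∨ v ∈ l →
      Relation.ReflTransGen (fun a b => a ∈ W ∧ b ∈ W ∧ (a, b) ∈ E) a v ∧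
      Relation.ReflTransGen (fun a b => a ∈ W ∧ b ∈ W ∧ (a, b) ∈ E) v (lst a l) := by
  induction l generalizing a with
  | nil =>
    intro v hv
    have : v = a := by simpa using hv
    subst this
    exact ⟨.refl, .refl⟩
  | cons j l ih =>
    have hj : j ∈ W := hl j (by simp)
    have h := ih j hj (fun v hv => hl v (by simp [hv])) ho.2
    have haj : Relation.ReflTransGen (fun a b => a ∈ W ∧ b ∈ W ∧ (a, b) ∈ E) a j := by
      rcases ho.1 with e | e
      · rw [e]
      · exact .single ⟨ha, hj, e⟩
    intro v hv
    by_cases hva : v = a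
    · subst hva
      exact ⟨.refl, haj.trans (h j (Or.inl rfl)).2⟩
    · have hv' := h v (by simpa [hva] using hv)
      exact ⟨haj.trans hv'.1, hv'.2⟩

theorem walk_sc {E : Set (V × V)} (l : List V) (hl : l ≠ []) (r : V) (hr : lst r l = r)
    (ho : okw E r l) : StronglyConnectedSub E l.toFinset := by
  have hrl : r ∈ l := by
    have := lst_mem l hl r
    rwa [hr] at this
  have h := walk_reach l.toFinset l r (by simpa using hrl) (by simp) ho
  rw [hr] at h
  refine ⟨⟨r, by simpa using hrl⟩, ?_⟩
  intro u hu v hv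
  exact (h u (Or.inr (by simpa using hu))).2.trans (h v (Or.inr (by simpa using hv))).1

end Comb
section Traces

set_option linter.unusedSectionVars false

variable {V : Type*} [Fintype V] [DecidableEq V]

theorem sum_ofFn_succ (n : ℕ) (F : List V → ℝ) :
    ∑ f : Fin (n+1) → V, F (List.ofFn f) = ∑ a : V, ∑ f : Fin n → V, F (a :: List.ofFn f) := by
  rw [← Fintype.sum_prod_type']
  refine (Fintype.sum_equiv (Fin.consEquiv (fun _ : Fin (n+1) => V)) _ _ ?_).symm
  rintro ⟨a, f⟩
  simp [Fin.consEquiv, List.ofFn_cons]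

theorem subm_pow (Q : Matrix V V ℝ) (W : Finset V) (n : ℕ) (a b : W) :
    ((subm Q W) ^ n) a b = ∑ f : Fin n → V,
      if (∀ c ∈ List.ofFn f, c ∈ W) ∧ lst (a : V) (List.ofFn f) = b
        then wt Q a (List.ofFn f) else 0 := by
  induction n generalizing a with
  | zero =>
    by_cases h : a = b
    · subst h; simp [lst, wt]
    · have hne : (a : V) ≠ b := fun e => h (Subtype.ext e)
      simp [lst, wt, h, hne]
  | succ n ih =>
    rw [pow_succ', Matrix.mul_apply, sum_ofFn_succ n (fun l => if (∀ c ∈ l, c ∈ W) ∧ lst (a : V) l = b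
        then wt Q a l else 0)]
    simp_rw [ih]
    have : ∀ j : V, (∑ f : Fin n → V, if (∀ c ∈ j :: List.ofFn f, c ∈ W) ∧
        lst (a : V) (j :: List.ofFn f) = b then wt Q a (j :: List.ofFn f) else 0) =
        if j ∈ W then Q a j * ∑ f : Fin n → V, (if (∀ c ∈ List.ofFn f, c ∈ W) ∧
          lst j (List.ofFn f) = b then wt Q j (List.ofFn f) else 0) else 0 := by
      intro j
      by_cases hj : j ∈ W
      · rw [if_pos hj, Finset.mul_sum]
        refine Finset.sum_congr rfl fun f _ => ?_
        rw [mul_ite, mul_zero]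
        simp only [List.forall_mem_cons, hj, true_and, lst, wt]
      · rw [if_neg hj]
        apply Finset.sum_eq_zero
        intro f _
        simp [hj]
    rw [Finset.sum_congr rfl fun j _ => this j, ← Finset.sum_filter]
    have hW : (Finset.univ.filter fun j => j ∈ W) = W := by ext; simp
    rw [hW, ← Finset.sum_coe_sort W]
    rfl

theorem subm_trace (Q : Matrix V V ℝ) (W : Finset V) (n : ℕ) (hn : n ≠ 0) :
    ((subm Q W) ^ n).trace = ∑ f : Fin n → V,
      if (List.ofFn f).toFinset ⊆ W
        then wt Q (lst (f ⟨0, Nat.pos_of_ne_zero hn⟩) (List.ofFn f)) (List.ofFn f) else 0 := by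
  simp only [Matrix.trace, Matrix.diag_apply, subm_pow]
  rw [Finset.sum_comm]
  refine Finset.sum_congr rfl fun f _ => ?_
  set l := List.ofFn f with hl
  have hl0 : l ≠ [] := by
    intro e
    have := congrArg List.length e
    simp [hl] at this
    exact hn this
  have hsub : l.toFinset ⊆ W ↔ ∀ c ∈ l, c ∈ W := by
    simp [Finset.subset_iff]
  set r := lst (f ⟨0, Nat.pos_of_ne_zero hn⟩) l with hr
  have hrl : r ∈ l := lst_mem l hl0 _
  have hlst : ∀ a, lst a l = r := fun a => lst_eq l hl0 _ _
  simp only [hlst, hsub]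
  by_cases h : ∀ c ∈ l, c ∈ W
  · rw [if_pos h, Finset.sum_eq_single ⟨r, h r hrl⟩]
    · rw [if_pos ⟨h, rfl⟩]
    · intro b _ hb
      have : r ≠ b := fun e => hb (Subtype.ext e.symm)
      simp [this]
    · simp
  · simp [h]

def liftMat (E : Set (V × V)) (Q : Matrix V V ℝ) : Matrix (STree E) (STree E) ℝ :=
  fun t t' => ∑ j, if sstep t j = t' then Q t.root j else 0

theorem liftMat_pow (E : Set (V × V)) (Q : Matrix V V ℝ)
    (hQ : ∀ i j, i ≠ j → (i, j) ∉ E → Q i j = 0) (n : ℕ) (t t' : STree E) :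
    ((liftMat E Q) ^ n) t t' = ∑ f : Fin n → V,
      if steps t (List.ofFn f) = t' then wt Q t.root (List.ofFn f) else 0 := by
  induction n generalizing t with
  | zero =>
    by_cases h : t = t'
    · subst h; simp [steps, wt]
    · simp [steps, wt, h]
  | succ n ih =>
    rw [pow_succ', Matrix.mul_apply, sum_ofFn_succ n (fun l => if steps t l = t'
        then wt Q t.root l else 0)]
    simp only [liftMat, Finset.sum_mul]
    rw [Finset.sum_comm]
    refine Finset.sum_congr rfl fun j _ => ?_
    simp only [ite_mul, zero_mul]
    rw [Finset.sum_ite_eq]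
    simp only [Finset.mem_univ, if_true]
    change Q t.root j * ((liftMat E Q) ^ n) (sstep t j) t' = _
    rw [ih]
    by_cases h0 : Q t.root j = 0
    · simp [h0, wt]
    · have hr : (sstep t j).root = j := by
        apply sstep_root
        by_contra hc
        push Not at hc
        exact h0 (hQ _ _ hc.1 hc.2)
      rw [hr, Finset.mul_sum]
      refine Finset.sum_congr rfl fun f _ => ?_
      rw [mul_ite, mul_zero]
      rfl

theorem liftMat_trace (E : Set (V × V)) (hconn : StronglyConnected E) (Q : Matrix V V ℝ)
    (hQ : ∀ i j, i ≠ j → (i, j) ∉ E → Q i j = 0) (m : Finset V → ℤ)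
    (hm : ∀ W, StronglyConnectedSub E W → (kForest E W : ℤ) =
      ∑ W' ∈ Finset.univ.filter (fun W' => StronglyConnectedSub E W'), if W ⊆ W' then m W' else 0)
    (n : ℕ) (hn : n ≠ 0) :
    ((liftMat E Q) ^ n).trace = ∑ W ∈ Finset.univ.filter (fun W => StronglyConnectedSub E W),
      (m W : ℝ) * ((subm Q W) ^ n).trace := by
  simp only [subm_trace Q _ n hn, Finset.mul_sum]
  simp only [Matrix.trace, Matrix.diag_apply]
  rw [Finset.sum_congr rfl fun t _ => liftMat_pow E Q hQ n t t, Finset.sum_comm]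
  conv_rhs => rw [Finset.sum_comm]
  refine Finset.sum_congr rfl fun f _ => ?_
  set l := List.ofFn f with hl
  have hl0 : l ≠ [] := by
    intro e
    have := congrArg List.length e
    simp [hl] at this
    exact hn this
  set r := lst (f ⟨0, Nat.pos_of_ne_zero hn⟩) l with hr
  have hrl : r ∈ l := lst_mem l hl0 _
  have hlst : ∀ a, lst a l = r := fun a => lst_eq l hl0 _ _
  have e1 : ∀ t : STree E, (if steps t l = t then wt Q t.root l else 0) =
      if t.root = r ∧ steps t l = t then wt Q r l else 0 := by
    intro t
    by_cases hs : steps t l = t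
    · by_cases htr : t.root = r
      · simp [hs, htr]
      · have : wt Q t.root l = 0 := by
          by_contra hc
          have := steps_root l t (wt_ok hQ l _ hc)
          rw [hs, hlst] at this
          exact htr this
        simp [htr, this]
    · simp [hs]
  rw [Finset.sum_congr rfl fun t _ => e1 t]
  by_cases hw : wt Q r l = 0
  · simp [hw]
  · have ho := wt_ok hQ l r hw
    have hc := count_fixed E hconn r l hl0 (hlst r) ho
    have hsc := walk_sc l hl0 r (hlst r) ho
    have hk := hm _ hsc
    rw [← Finset.sum_filter, Finset.sum_const, ← Fintype.card_subtype, ← Nat.card_eq_fintype_card,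
      hc, nsmul_eq_mul]
    have hk' : (kForest E l.toFinset : ℝ) =
      ∑ W' ∈ Finset.univ.filter (fun W' => StronglyConnectedSub E W'),
        if l.toFinset ⊆ W' then (m W' : ℝ) else 0 := by
      have := congrArg (Int.cast : ℤ → ℝ) hk
      simpa using this
    rw [hk', Finset.sum_mul]
    refine Finset.sum_congr rfl fun W _ => ?_
    rw [mul_ite, ite_mul, mul_zero, zero_mul]

theorem liftMat_one (E : Set (V × V)) : liftMat E (1 : Matrix V V ℝ) = 1 := by
  ext t t'
  unfold liftMat
  rw [Finset.sum_eq_single t.root]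
  · have : sstep t t.root = t := by
      apply Subtype.ext
      simp [sstep, stepF, STree.root]
    rw [this]
    by_cases h : t = t'
    · subst h; simp
    · simp [h]
  · intro b _ hb
    simp [Matrix.one_apply, Ne.symm hb]
  · simp

theorem liftMat_trace' (E : Set (V × V)) (hconn : StronglyConnected E) (Q : Matrix V V ℝ)
    (hQ : ∀ i j, i ≠ j → (i, j) ∉ E → Q i j = 0) (m : Finset V → ℤ)
    (hm : ∀ W, StronglyConnectedSub E W → (kForest E W : ℤ) =
      ∑ W' ∈ Finset.univ.filter (fun W' => StronglyConnectedSub E W'), if W ⊆ W' then m W' else 0)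
    (n : ℕ) :
    ((liftMat E Q) ^ n).trace = ∑ W ∈ Finset.univ.filter (fun W => StronglyConnectedSub E W),
      (m W : ℝ) * ((subm Q W) ^ n).trace := by
  by_cases hn : n = 0
  · subst hn
    have h := liftMat_trace E hconn (1 : Matrix V V ℝ) (fun i j hij _ => by simp [hij]) m hm 1 one_ne_zero
    rw [liftMat_one] at h
    have hs : ∀ W : Finset V, subm (1 : Matrix V V ℝ) W = 1 := fun W => by
      unfold subm
      exact Matrix.submatrix_one _ Subtype.val_injective
    simp only [hs, one_pow] at h
    simpa only [pow_zero] using h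
  · exact liftMat_trace E hconn Q hQ m hm n hn

end Traces
section Final

variable {V : Type*} [Fintype V] [DecidableEq V]

def liftW (E : Set (V × V)) (x : V → V → ℝ) : STree E → STree E → ℝ :=
  fun t t' => if STreeEdge E t t' then x t.root t'.root else 0

theorem sstep_eq_iff {E : Set (V × V)} (hloop : ∀ v : V, (v, v) ∉ E) (t t' : STree E) (j : V)
    (h : (t.root, j) ∈ E) : sstep t j = t' ↔ j = t'.root ∧ STreeEdge E t t' := by
  have hne : t.root ≠ j := fun e => hloop j (by rwa [e] at h)
  have hr := sstep_root t j (Or.inr h)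
  have ht := sstep_tree t j (Or.inr h)
  constructor
  · rintro rfl
    refine ⟨hr.symm, ?_, ?_, ?_⟩
    · rw [hr]; exact hne
    · rw [hr]; exact h
    · rw [hr]; exact ht
  · rintro ⟨rfl, h1, h2, h3⟩
    apply stree_ext hr
    intro v
    rw [ht, h3]

theorem liftW_eq (E : Set (V × V)) (hloop : ∀ v : V, (v, v) ∉ E) (x : V → V → ℝ)
    (hx : ∀ i j : V, (i, j) ∉ E → x i j = 0) (t t' : STree E) :
    liftW E x t t' = ∑ j, if sstep t j = t' then x t.root j else 0 := by
  have : ∀ j, (if sstep t j = t' then x t.root j else 0) =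
      if t'.root = j then liftW E x t t' else 0 := by
    intro j
    by_cases h : (t.root, j) ∈ E
    · rw [liftW]
      simp only [sstep_eq_iff hloop t t' j h]
      by_cases hj : j = t'.root
      · subst hj; simp
      · simp [hj, Ne.symm hj]
    · rw [hx _ _ h]
      by_cases hj : t'.root = j
      · subst hj
        have : ¬ STreeEdge E t t' := fun e => h e.2.1
        simp [liftW, this]
      · simp [hj]
  rw [Finset.sum_congr rfl fun j _ => this j]
  simp

theorem liftMat_lapl (E : Set (V × V)) (hloop : ∀ v : V, (v, v) ∉ E) (x : V → V → ℝ)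
    (hx : ∀ i j : V, (i, j) ∉ E → x i j = 0) :
    liftMat E (-(lapl x)) = -(lapl (liftW E x)) := by
  ext t t'
  have hself : sstep t t.root = t := by
    apply Subtype.ext
    simp [sstep, stepF, STree.root]
  have hsum : ∑ s, liftW E x t s = ∑ k, x t.root k := by
    simp_rw [liftW_eq E hloop x hx]
    rw [Finset.sum_comm]
    simp
  have h1 : ∀ j, (if sstep t j = t' then (-(lapl x)) t.root j else 0) =
      (if sstep t j = t' then x t.root j else 0) -
      (if t.root = j then (if t = t' then ∑ k, x t.root k else 0) else 0) := by
    intro j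
    by_cases hj : t.root = j
    · subst hj
      rw [hself]
      by_cases h : t = t'
      · simp [h, lapl]
      · simp [h]
    · by_cases h : sstep t j = t'
      · simp [h, hj, lapl]
      · simp [h, hj]
  unfold liftMat
  rw [Finset.sum_congr rfl fun j _ => h1 j, Finset.sum_sub_distrib, ← liftW_eq E hloop x hx]
  simp [lapl, hsum]

theorem kForest_univ (E : Set (V × V)) : kForest E (Finset.univ : Finset V) = 1 := by
  unfold kForest
  rw [Nat.card_eq_one_iff_exists]
  refine ⟨⟨id, ?_, ?_, ?_⟩, ?_⟩
  · intros; rfl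
  · intro v hv; simp at hv
  · intro v; exact ⟨0, Finset.mem_univ _⟩
  · rintro ⟨f, hf⟩
    apply Subtype.ext
    funext v
    exact hf.1 v (Finset.mem_univ v)

theorem sc_univ [Nonempty V] (E : Set (V × V)) (hconn : StronglyConnected E) :
    StronglyConnectedSub E (Finset.univ : Finset V) := by
  refine ⟨Finset.univ_nonempty, fun u _ v _ => ?_⟩
  have := hconn u v
  simpa using this

end Final

/-- Biane–Chapuy's formula: `τ(Ḡ)/τ(G) = ∏_W Ψ_{V∖W}^{m'(W)}`, the product
ranging over strongly connected proper subsets `W ⊊ V`. -/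
theorem stmt5 {V : Type*} [Fintype V] [DecidableEq V] [Nonempty V]
    (E : Set (V × V)) (hloop : ∀ v : V, (v, v) ∉ E) (hconn : StronglyConnected E)
    (x : V → V → ℝ) (hx : ∀ i j : V, (i, j) ∉ E → x i j = 0)
    (m' : Finset V → ℤ)
    (hm'univ : m' Finset.univ = 1)
    (hm' : ∀ W : Finset V, StronglyConnectedSub E W → W ≠ Finset.univ →
      m' W = (kForest E W : ℤ) -
        ∑ W' ∈ Finset.univ.filter (fun W' => StronglyConnectedSub E W' ∧ W ⊂ W'), m' W') :
    (∑ T : STree (liftEdges E),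
        ∏ t ∈ Finset.univ.erase T.root, x (STree.root t) (STree.root (T.tree t))) *
      ∏ W ∈ Finset.univ.filter (fun W : Finset V =>
          StronglyConnectedSub E W ∧ W ≠ Finset.univ),
        forestWeightSum E x Wᶜ ^ (-(m' W)).toNat
    = (∑ t : STree E, treeWeight x t) *
      ∏ W ∈ Finset.univ.filter (fun W : Finset V =>
          StronglyConnectedSub E W ∧ W ≠ Finset.univ),
        forestWeightSum E x Wᶜ ^ (m' W).toNat := by
  have hsu := sc_univ E hconn
  have hm : ∀ W, StronglyConnectedSub E W → (kForest E W : ℤ) =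
      ∑ W' ∈ Finset.univ.filter (fun W' => StronglyConnectedSub E W'),
        if W ⊆ W' then m' W' else 0 := by
    intro W hW
    rw [← Finset.sum_filter, Finset.filter_filter]
    by_cases hu : W = Finset.univ
    · subst hu
      have : (Finset.univ.filter fun W' : Finset V =>
          StronglyConnectedSub E W' ∧ Finset.univ ⊆ W') = {Finset.univ} := by
        ext W'
        simp only [Finset.mem_filter, Finset.mem_univ, true_and, Finset.univ_subset_iff,
          Finset.mem_singleton]
        exact ⟨fun h => h.2, fun h => ⟨h ▸ hsu, h⟩⟩
      rw [this, Finset.sum_singleton, hm'univ, kForest_univ]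
      rfl
    · have : (Finset.univ.filter fun W' : Finset V => StronglyConnectedSub E W' ∧ W ⊆ W') =
          insert W (Finset.univ.filter fun W' => StronglyConnectedSub E W' ∧ W ⊂ W') := by
        ext W'
        simp only [Finset.mem_filter, Finset.mem_univ, true_and, Finset.mem_insert]
        constructor
        · rintro ⟨h1, h2⟩
          rcases eq_or_ssubset_of_subset h2 with h | h
          · exact Or.inl h.symm
          · exact Or.inr ⟨h1, h⟩
        · rintro (rfl | ⟨h1, h2⟩)
          · exact ⟨hW, subset_rfl⟩
          · exact ⟨h1, h2.subset⟩
      rw [this, Finset.sum_insert (by simp), hm' W hW hu]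
      ring
  have hQ : ∀ i j, i ≠ j → (i, j) ∉ E → (-(lapl x)) i j = 0 := by
    intro i j hij h
    simp [lapl, hij, hx i j h]
  have htr := liftMat_trace' E hconn (-(lapl x)) hQ m' hm
  have hch := charpoly_of_traces (Finset.univ.filter fun W => StronglyConnectedSub E W)
    (liftMat E (-(lapl x))) (fun W => subm (-(lapl x)) W) m' htr
  rw [liftMat_lapl E hloop x hx] at hch
  have hs : (Finset.univ.filter fun W : Finset V => StronglyConnectedSub E W) =
      insert Finset.univ (Finset.univ.filter (fun W : Finset V =>
          StronglyConnectedSub E W ∧ W ≠ Finset.univ)) := by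
    ext W
    simp only [Finset.mem_filter, Finset.mem_univ, true_and, Finset.mem_insert]
    constructor
    · intro h
      by_cases hu : W = Finset.univ
      · exact Or.inl hu
      · exact Or.inr ⟨h, hu⟩
    · rintro (rfl | h)
      · exact hsu
      · exact h.1
  have hni : Finset.univ ∉ (Finset.univ.filter (fun W : Finset V =>
          StronglyConnectedSub E W ∧ W ≠ Finset.univ)) := by simp
  rw [hs, Finset.prod_insert hni, Finset.prod_insert hni, hm'univ] at hch
  have hpu : (subm (-(lapl x)) Finset.univ).charpoly = (-(lapl x)).charpoly := by
    have := Matrix.charpoly_reindex (Equiv.subtypeUnivEquiv (Finset.mem_univ (α := V))).symm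
      (-(lapl x))
    rw [← this]
    rfl
  rw [hpu] at hch
  have t1 : ((-(1 : ℤ)).toNat) = 0 := rfl
  have t2 : ((1 : ℤ).toNat) = 1 := rfl
  rw [t1, t2, pow_zero, one_mul, pow_one] at hch
  obtain ⟨t0, -⟩ := exists_tree E hconn (Classical.arbitrary V)
  haveI : Nonempty (STree E) := ⟨t0⟩
  have hco := congrArg (fun p => Polynomial.coeff p 1) hch
  have hmul : ∀ p q : Polynomial ℝ, p.coeff 0 = 0 → (p * q).coeff 1 = p.coeff 1 * q.coeff 0 := by
    intro p q hp
    rw [Polynomial.mul_coeff_one, hp]; ring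
  rw [hmul _ _ (by rw [charpoly_neg_coeff_zero, lapl_det]),
    hmul _ _ (by rw [charpoly_neg_coeff_zero, lapl_det]),
    coeff_one_lapl E x hx,
    coeff_one_lapl (liftEdges E) (liftW E x) (fun t t' h => if_neg h)] at hco
  have hp : ∀ e : Finset V → ℕ, (∏ W ∈ Finset.univ.filter (fun W : Finset V =>
          StronglyConnectedSub E W ∧ W ≠ Finset.univ),
        (subm (-(lapl x)) W).charpoly ^ e W).coeff 0 = ∏ W ∈ Finset.univ.filter (fun W : Finset V =>
          StronglyConnectedSub E W ∧ W ≠ Finset.univ), forestWeightSum E x Wᶜ ^ e W := by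
    intro e
    rw [Polynomial.coeff_zero_prod]
    refine Finset.prod_congr rfl fun W _ => ?_
    rw [Polynomial.coeff_zero_eq_eval_zero, Polynomial.eval_pow,
      ← Polynomial.coeff_zero_eq_eval_zero, ← forest_det E x hx, ← charpoly_neg_coeff_zero]
    rfl
  rw [hp (fun W => (-(m' W)).toNat), hp (fun W => (m' W).toNat)] at hco
  rw [← hco]
  congr 1
  refine Finset.sum_congr rfl fun T _ => ?_
  unfold treeWeight
  apply Finset.prod_congr
  · congr
  · intro t ht
    have : STreeEdge E t (T.tree t) := T.2.2.1 t (Finset.ne_of_mem_erase ht)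
    simp [liftW, this]

end
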